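/- arXiv:2312.14205 — 2 statements merged into one kernel-verified Lean document; each statement's English description precedes it below -/
import Mathlib

section
/- Let C ⊆ ℝ² be a nonempty compact path-connected set which equals the closure of its interior, and suppose the topological frontier of C is the union of the images of finitely many rectifiable Jordan loops γ₁, …, γ_n with pairwise disjoint images. Then there exists an index i₀ ∈ {1, …, n} such that for every point z' in the image of γ_{i₀} and every x ∈ C: d_chem^C(x, z') ≤ length(γ_{i₀}) + (1/2) Σ_{j ≠ i₀} length(γ_j). -/
open Set
open scoped ENNReal

noncomputable section

abbrev Plane : Type := EuclideanSpace ℝ (Fin 2)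

/-- The chemical distance in `E`: infimum of Euclidean lengths of continuous rectifiable
paths from `x` to `y` contained in `E` (`∞` if no such path exists). -/
def chemDist (E : Set Plane) (x y : Plane) : ℝ≥0∞ :=
  ⨅ (γ : ℝ → Plane) (_ : ContinuousOn γ (Set.Icc 0 1) ∧ γ 0 = x ∧ γ 1 = y ∧
      Set.MapsTo γ (Set.Icc 0 1) E), eVariationOn γ (Set.Icc 0 1)

/-- The chemical diameter of a set. -/
def diamChem (A : Set Plane) : ℝ≥0∞ := ⨆ x ∈ A, ⨆ y ∈ A, chemDist A x y

/-- A rectifiable Jordan loop: continuous on `[0,1]`, closed, injective on `[0,1)`,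
of finite total variation. -/
def IsRectifiableJordanLoop (γ : ℝ → Plane) : Prop :=
  ContinuousOn γ (Set.Icc 0 1) ∧ γ 0 = γ 1 ∧ Set.InjOn γ (Set.Ico 0 1) ∧
    eVariationOn γ (Set.Icc 0 1) ≠ ⊤

theorem IsPreconnected.eq_of_integer_valued {X : Type*} [TopologicalSpace X] {S : Set X}
    (hS : IsPreconnected S) {g : X → ℝ} (hg : ContinuousOn g S)
    (hint : ∀ x ∈ S, ∃ m : ℤ, g x = m) {x y : X} (hx : x ∈ S) (hy : y ∈ S) : g x = g y :=
  hS.constant_of_mapsTo Int.isClosedEmbedding_coe_real.isEmbedding.isDiscrete_range hg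
    (fun z hz => by
      obtain ⟨m, hm⟩ := hint z hz
      exact ⟨m, hm.symm⟩) hx hy

/-- If the frontier of a closed preconnected set `C` in a normed space splits into two disjoint
closed pieces, then a preconnected set avoiding the interior of `C` cannot meet both pieces. -/
theorem IsPreconnected.frontier_pieces_not_both_met {E : Type*} [NormedAddCommGroup E]
    [NormedSpace ℝ E] {C A B W : Set E} (hC : IsPreconnected C)
    (hCcl : IsClosed C) (hA : IsClosed A) (hB : IsClosed B) (hAB : Disjoint A B)
    (hfr : frontier C ⊆ A ∪ B) (hW : IsPreconnected W) (hWC : Disjoint W (interior C))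
    {a b : E} (haA : a ∈ A) (hbB : b ∈ B) (haC : a ∈ C) (hbC : b ∈ C) (haW : a ∈ W)
    (hbW : b ∈ W) : False := by
  classical
  obtain ⟨φ, h0, h1, -⟩ := exists_continuous_zero_one_of_isClosed hA hB hAB
  let f : E → AddCircle (1 : ℝ) := fun x => if x ∈ C then (φ x : AddCircle (1 : ℝ)) else 0
  have hfzero : ∀ x, x ∉ interior C → f x = 0 := by
    intro x hx
    by_cases hxC : x ∈ C
    · have hxf : x ∈ frontier C := by rw [hCcl.frontier_eq]; exact ⟨hxC, hx⟩
      simp only [f, hxC, if_true]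
      rw [AddCircle.coe_eq_zero_iff]
      rcases hfr hxf with h | h
      · exact ⟨0, by simp [h0 h]⟩
      · exact ⟨1, by simp [h1 h]⟩
    · simp [f, hxC]
  have hf : Continuous f := by
    refine Continuous.if (fun x hx => ?_) ?_ continuous_const
    · have hxC : x ∈ C := hCcl.frontier_subset hx
      have := hfzero x (by
        have hx' : x ∈ frontier C := hx
        rw [hCcl.frontier_eq] at hx'
        exact hx'.2)
      simpa [f, hxC] using this
    · exact (AddCircle.continuous_mk' 1).comp φ.continuous
  obtain ⟨e₀, he₀⟩ : ∃ e₀ : ℝ, (e₀ : AddCircle (1 : ℝ)) = f a := QuotientAddGroup.mk_surjective _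
  obtain ⟨θ, ⟨-, hθ⟩, -⟩ := (AddCircle.isCoveringMap_coe (1 : ℝ)).existsUnique_continuousMap_lifts
    ⟨f, hf⟩ a e₀ he₀
  have hθ' : ∀ x, ((θ x : ℝ) : AddCircle (1 : ℝ)) = f x := fun x => congr_fun hθ x
  have eqC : θ a - φ a = θ b - φ b := by
    refine hC.eq_of_integer_valued (g := fun x => θ x - φ x) (by fun_prop) ?_ haC hbC
    intro x hx
    have : ((θ x - φ x : ℝ) : AddCircle (1 : ℝ)) = 0 := by
      rw [AddCircle.coe_sub, hθ' x]
      simp [f, hx]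
    obtain ⟨m, hm⟩ := (AddCircle.coe_eq_zero_iff (1 : ℝ)).1 this
    exact ⟨m, by simpa using hm.symm⟩
  have eqW : θ a = θ b := by
    refine hW.eq_of_integer_valued (g := θ) (by fun_prop) ?_ haW hbW
    intro x hx
    obtain ⟨m, hm⟩ := (AddCircle.coe_eq_zero_iff (1 : ℝ)).1
      ((hθ' x).trans (hfzero x fun h => hWC.le_bot ⟨hx, h⟩))
    exact ⟨m, by simpa using hm.symm⟩
  have ha : φ a = 0 := h0 haA
  have hb : φ b = 1 := h1 hbB
  linarith

/-- If the frontier of a closed preconnected set `C` is a finite disjoint union of closed sets, a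
preconnected set avoiding the interior of `C` meets `C` in only one of them. -/
theorem IsPreconnected.exists_frontier_component {E ι : Type*} [NormedAddCommGroup E]
    [NormedSpace ℝ E] [Finite ι] {C W : Set E} {K : ι → Set E} (hC : IsPreconnected C)
    (hCcl : IsClosed C) (hK : ∀ i, IsClosed (K i)) (hdisj : ∀ i j, i ≠ j → Disjoint (K i) (K j))
    (hfr : frontier C = ⋃ i, K i) (hW : IsPreconnected W) (hWC : Disjoint W (interior C))
    {a b : E} (haC : a ∈ C) (hbC : b ∈ C) (haW : a ∈ W) (hbW : b ∈ W) :
    ∃ i, a ∈ K i ∧ b ∈ K i := by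
  have key : ∀ x ∈ C, x ∈ W → ∃ i, x ∈ K i := fun x hx hxW => by
    have : x ∈ frontier C := by
      rw [hCcl.frontier_eq]; exact ⟨hx, fun h => hWC.le_bot ⟨hxW, h⟩⟩
    rw [hfr] at this
    exact mem_iUnion.1 this
  obtain ⟨i, hi⟩ := key a haC haW
  obtain ⟨j, hj⟩ := key b hbC hbW
  refine ⟨i, hi, ?_⟩
  by_contra hb
  have hij : j ≠ i := fun h => hb (h ▸ hj)
  refine hC.frontier_pieces_not_both_met hCcl (hK i)
    (B := ⋃ k : {k // k ≠ i}, K k) (isClosed_iUnion_of_finite fun k => hK k) ?_ ?_ hW hWC hi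
    (mem_iUnion.2 ⟨⟨j, hij⟩, hj⟩) haC hbC haW hbW
  · exact disjoint_iUnion_right.2 fun k => hdisj _ _ k.2.symm
  · rw [hfr]
    refine iUnion_subset fun k => ?_
    by_cases hk : k = i
    · exact hk ▸ subset_union_left
    · exact (subset_iUnion (fun k : {k // k ≠ i} => K k) ⟨k, hk⟩).trans subset_union_right

/-- `y ∈ C` is the last point of `C` on some ray. -/
def IsRayTip (C : Set Plane) (y : Plane) : Prop :=
  y ∈ C ∧ ∃ u : Plane, u ≠ 0 ∧ ∀ t : ℝ, 0 < t → y + t • u ∉ C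

theorem IsCompact.exists_isRayTip {C : Set Plane} (hC : IsCompact C) {x u : Plane} (hx : x ∈ C)
    (hu : u ≠ 0) : ∃ t : ℝ, 0 ≤ t ∧ IsRayTip C (x + t • u) := by
  have hu' : 0 < ‖u‖ := norm_pos_iff.2 hu
  obtain ⟨R, hR⟩ := hC.isBounded.exists_norm_le
  let T : Set ℝ := {t | 0 ≤ t ∧ x + t • u ∈ C}
  have hTcl : IsClosed T := by
    refine isClosed_Ici.inter (hC.isClosed.preimage (f := fun t : ℝ => x + t • u) (by fun_prop))
  have hTb : ∀ t ∈ T, t ≤ 2 * R / ‖u‖ := by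
    rintro t ⟨ht0, ht⟩
    rw [le_div_iff₀ hu']
    have h1 : ‖t • u‖ = t * ‖u‖ := by rw [norm_smul, Real.norm_of_nonneg ht0]
    have h2 : t • u = (x + t • u) - x := by abel
    have h3 := norm_sub_le (x + t • u) x
    rw [← h2, h1] at h3
    linarith [hR _ ht, hR _ hx]
  have hTc : IsCompact T := isCompact_Icc.of_isClosed_subset hTcl fun t ht => ⟨ht.1, hTb t ht⟩
  obtain ⟨t, ⟨ht0, htC⟩, hmax⟩ := hTc.exists_isGreatest ⟨0, le_rfl, by simpa using hx⟩
  refine ⟨t, ht0, htC, u, hu, fun r hr hmem => ?_⟩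
  have : t + r ≤ t := hmax ⟨by positivity, by rwa [add_smul, ← add_assoc]⟩
  linarith

/-- All ray tips of a compact connected planar set lie on the same piece of its frontier. -/
theorem IsRayTip.exists_frontier_component {ι : Type*} [Finite ι] {C : Set Plane}
    {K : ι → Set Plane} (hC : IsPreconnected C) (hcomp : IsCompact C)
    (hK : ∀ i, IsClosed (K i)) (hdisj : ∀ i j, i ≠ j → Disjoint (K i) (K j))
    (hfr : frontier C = ⋃ i, K i) {a b : Plane} (ha : IsRayTip C a) (hb : IsRayTip C b) :
    ∃ i, a ∈ K i ∧ b ∈ K i := by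
  obtain ⟨R, hRpos, hR⟩ := hcomp.isBounded.exists_pos_norm_lt
  let S : Set Plane := Metric.sphere 0 R
  have hS : IsPreconnected S := isPreconnected_sphere (by
    rw [← Module.finrank_eq_rank]; simp) _ _
  have hSC : Disjoint S (interior C) := disjoint_left.2 fun p hp hpC => by
    have := hR p (interior_subset hpC)
    simp [S] at hp
    linarith
  have ray : ∀ y, IsRayTip C y → ∃ W : Set Plane, IsPreconnected W ∧ Disjoint W (interior C) ∧
      y ∈ W ∧ (W ∩ S).Nonempty := by
    rintro y ⟨hy, u, hu, hray⟩
    have hu' : 0 < ‖u‖ := norm_pos_iff.2 hu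
    have hcont : Continuous fun t : ℝ => y + t • u := by fun_prop
    have hoff : ∀ t : ℝ, 0 ≤ t → y + t • u ∉ interior C := by
      intro t ht hmem
      have hnear : ∀ᶠ s in nhdsWithin t (Ioi t), y + s • u ∈ interior C :=
        (hcont.continuousAt.eventually (isOpen_interior.mem_nhds hmem)).filter_mono
          nhdsWithin_le_nhds
      obtain ⟨s, hs, hts⟩ := (hnear.and self_mem_nhdsWithin).exists
      exact hray s (ht.trans_lt hts) (interior_subset hs)
    refine ⟨(fun t : ℝ => y + t • u) '' Ici 0, isPreconnected_Ici.image _ hcont.continuousOn, ?_,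
      ⟨0, by simp, by simp⟩, ?_⟩
    · rw [disjoint_left]
      rintro _ ⟨t, ht, rfl⟩
      exact hoff t ht
    · have hfar : R ≤ ‖y + (2 * R / ‖u‖) • u‖ := by
        have h1 : ‖(2 * R / ‖u‖) • u‖ = 2 * R := by
          rw [norm_smul, Real.norm_of_nonneg (by positivity)]; field_simp
        have h2 := norm_sub_le (y + (2 * R / ‖u‖) • u) y
        rw [add_sub_cancel_left, h1] at h2
        linarith [hR y hy]
      obtain ⟨t, ht, hteq⟩ := intermediate_value_Icc (a := (0 : ℝ)) (b := 2 * R / ‖u‖)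
        (by positivity) (f := fun t : ℝ => ‖y + t • u‖) (by fun_prop)
        ⟨by simpa using (hR y hy).le, hfar⟩
      exact ⟨y + t • u, ⟨t, ht.1, rfl⟩, by simpa [S] using hteq⟩
  obtain ⟨V, hV, hVC, haV, p, hpV, hpS⟩ := ray a ha
  obtain ⟨W, hW, hWC, hbW, q, hqW, hqS⟩ := ray b hb
  refine hC.exists_frontier_component hcomp.isClosed hK hdisj hfr
    ((hV.union p hpV hpS hS).union q (Or.inr hqS) hqW hW)
    (disjoint_union_left.2 ⟨disjoint_union_left.2 ⟨hVC, hSC⟩, hWC⟩) ha.1 hb.1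
    (Or.inl (Or.inl haV)) (Or.inr hbW)

section Curves

variable {X : Type*} [PseudoEMetricSpace X]

theorem exists_glued_curve {f g : ℝ → X} {a b c : ℝ} (hab : a ≤ b) (hbc : b ≤ c)
    (hf : ContinuousOn f (Icc a b)) (hg : ContinuousOn g (Icc b c)) (h : f b = g b) :
    ∃ k : ℝ → X, ContinuousOn k (Icc a c) ∧ EqOn k f (Icc a b) ∧ EqOn k g (Icc b c) ∧
      eVariationOn k (Icc a c) = eVariationOn f (Icc a b) + eVariationOn g (Icc b c) := by
  let k : ℝ → X := fun t => if t ≤ b then f t else g t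
  have hkf : EqOn k f (Icc a b) := fun t ht => by simp [k, ht.2]
  have hkg : EqOn k g (Icc b c) := fun t ht => by
    rcases ht.1.eq_or_lt with rfl | hlt
    · simp [k, h]
    · simp [k, not_le.2 hlt]
  refine ⟨k, ?_, hkf, hkg, ?_⟩
  · rw [← Icc_union_Icc_eq_Icc hab hbc]
    exact (hf.congr hkf).union_of_isClosed (hg.congr hkg) isClosed_Icc isClosed_Icc
  · have := eVariationOn.Icc_add_Icc k (s := univ) hab hbc (mem_univ b)
    simp only [univ_inter] at this
    rw [← this, eVariationOn.congr hkf, eVariationOn.congr hkg]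

/-- The points `p` and `q` are joined inside `E` by a curve of length at most `ℓ`, which can be
parametrized by any nondegenerate interval. -/
def JoinedByLength (E : Set X) (p q : X) (ℓ : ℝ≥0∞) : Prop :=
  ∀ a b : ℝ, a < b → ∃ g : ℝ → X, ContinuousOn g (Icc a b) ∧ g a = p ∧ g b = q ∧
    MapsTo g (Icc a b) E ∧ eVariationOn g (Icc a b) ≤ ℓ

theorem JoinedByLength.mono {E : Set X} {p q : X} {ℓ ℓ' : ℝ≥0∞} (h : JoinedByLength E p q ℓ)
    (hℓ : ℓ ≤ ℓ') : JoinedByLength E p q ℓ' := fun a b hab => by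
  obtain ⟨g, h1, h2, h3, h4, h5⟩ := h a b hab
  exact ⟨g, h1, h2, h3, h4, h5.trans hℓ⟩

theorem JoinedByLength.of_curve {E : Set X} {γ : ℝ → X} {c d : ℝ} (hcd : c ≤ d)
    (hγ : ContinuousOn γ (Icc c d)) (hE : MapsTo γ (Icc c d) E) :
    JoinedByLength E (γ c) (γ d) (eVariationOn γ (Icc c d)) := fun a b hab => by
  have hba : 0 < b - a := sub_pos.2 hab
  let φ : ℝ → ℝ := fun t => c + (t - a) / (b - a) * (d - c)
  have hφ : Continuous φ := by fun_prop
  have hmono : Monotone φ := fun s t hst => by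
    have : 0 ≤ d - c := sub_nonneg.2 hcd
    dsimp only [φ]
    gcongr
  have ha : φ a = c := by simp [φ]
  have hb : φ b = d := by simp [φ, div_self hba.ne']
  have hmaps : MapsTo φ (Icc a b) (Icc c d) := fun t ht =>
    ⟨ha ▸ hmono ht.1, hb ▸ hmono ht.2⟩
  exact ⟨γ ∘ φ, hγ.comp hφ.continuousOn hmaps, by simp [ha], by simp [hb], hE.comp hmaps,
    eVariationOn.comp_le_of_monotoneOn γ φ (hmono.monotoneOn _) hmaps⟩

theorem JoinedByLength.symm {E : Set X} {p q : X} {ℓ : ℝ≥0∞} (h : JoinedByLength E p q ℓ) :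
    JoinedByLength E q p ℓ := fun a b hab => by
  obtain ⟨g, h1, h2, h3, h4, h5⟩ := h a b hab
  let φ : ℝ → ℝ := fun t => a + b - t
  have hmaps : MapsTo φ (Icc a b) (Icc a b) := fun t ht =>
    ⟨by simp only [φ]; linarith [ht.2], by simp only [φ]; linarith [ht.1]⟩
  have hanti : Antitone φ := fun s t hst => by simp only [φ]; linarith
  exact ⟨g ∘ φ, h1.comp (by fun_prop) hmaps, by simpa [φ] using h3, by simpa [φ] using h2,
    h4.comp hmaps, (eVariationOn.comp_le_of_antitoneOn g φ (hanti.antitoneOn _) hmaps).trans h5⟩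

theorem JoinedByLength.trans {E : Set X} {p q r : X} {ℓ ℓ' : ℝ≥0∞} (h : JoinedByLength E p q ℓ)
    (h' : JoinedByLength E q r ℓ') : JoinedByLength E p r (ℓ + ℓ') := fun a b hab => by
  obtain ⟨m, ham, hmb⟩ := exists_between hab
  obtain ⟨f, f1, f2, f3, f4, f5⟩ := h a m ham
  obtain ⟨g, g1, g2, g3, g4, g5⟩ := h' m b hmb
  obtain ⟨k, k1, kf, kg, k2⟩ := exists_glued_curve ham.le hmb.le f1 g1 (f3.trans g2.symm)
  refine ⟨k, k1, (kf (left_mem_Icc.2 ham.le)).trans f2, (kg (right_mem_Icc.2 hmb.le)).trans g3,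
    ?_, k2.trans_le (add_le_add f5 g5)⟩
  rw [← Icc_union_Icc_eq_Icc ham.le hmb.le]
  exact (f4.congr kf.symm).union (g4.congr kg.symm)

/-- Any two points of a closed curve are joined along it by an arc of at most half its length. -/
theorem JoinedByLength.of_loop {γ : ℝ → X} (hγ : ContinuousOn γ (Icc 0 1)) (hloop : γ 0 = γ 1)
    {p q : X} (hp : p ∈ γ '' Icc 0 1) (hq : q ∈ γ '' Icc 0 1) :
    JoinedByLength (γ '' Icc 0 1) p q (1 / 2 * eVariationOn γ (Icc 0 1)) := by
  obtain ⟨u, hu, rfl⟩ := hp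
  obtain ⟨v, hv, rfl⟩ := hq
  wlog huv : u ≤ v generalizing u v
  · exact (this v hv u hu (le_of_not_ge huv)).symm
  have arc : ∀ c d : ℝ, 0 ≤ c → c ≤ d → d ≤ 1 →
      JoinedByLength (γ '' Icc 0 1) (γ c) (γ d) (eVariationOn γ (Icc c d)) := by
    intro c d h0 hcd h1
    have hsub : Icc c d ⊆ Icc (0 : ℝ) 1 := Icc_subset_Icc h0 h1
    exact .of_curve hcd (hγ.mono hsub) fun t ht => mem_image_of_mem γ (hsub ht)
  have inner := arc u v hu.1 huv hv.2
  have outer := (arc 0 u le_rfl hu.1 hu.2).symm.trans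
    (hloop ▸ (arc v 1 hv.1 hv.2 le_rfl).symm)
  have e1 := eVariationOn.Icc_add_Icc γ (s := univ) hu.1 huv (mem_univ u)
  have e2 := eVariationOn.Icc_add_Icc γ (s := univ) hv.1 hv.2 (mem_univ v)
  simp only [univ_inter] at e1 e2
  rw [← e2, ← e1]
  set A := eVariationOn γ (Icc 0 u)
  set B := eVariationOn γ (Icc u v)
  set D := eVariationOn γ (Icc v 1)
  rcases le_or_gt B (1 / 2 * (A + B + D)) with h | h
  · exact inner.mono h
  · refine outer.mono (le_of_not_gt fun h' => ?_)
    have := ENNReal.add_lt_add h h'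
    rw [← add_mul, one_div, ENNReal.inv_two_add_inv_two, one_mul] at this
    exact this.ne (by ring)

/-- Shortcut a curve through a closed set `K`: between its first and last visits to `K`, replace it
by a curve inside `K`. -/
theorem exists_shortcut {K : Set X} (hK : IsClosed K) {ℓ : ℝ≥0∞}
    (hj : ∀ p ∈ K, ∀ q ∈ K, JoinedByLength K p q ℓ) {c : ℝ → X}
    (hc : ContinuousOn c (Icc 0 1)) :
    ∃ c' : ℝ → X, ContinuousOn c' (Icc 0 1) ∧ c' 0 = c 0 ∧ c' 1 = c 1 ∧
      eVariationOn c' (Icc 0 1) ≤ eVariationOn c (Icc 0 1) + ℓ ∧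
      (∀ t ∈ Icc (0 : ℝ) 1, c' t ∈ K ∨ c' t = c t) ∧
      (∀ u ∈ Icc (0 : ℝ) 1, ∀ v ∈ Icc (0 : ℝ) 1, (∀ t ∈ Ioo u v, c t ∉ K) →
        (∀ t ∈ Ioo u v, c' t ∈ K) ∨ EqOn c' c (Icc u v)) ∧
      (∀ u ∈ Icc (0 : ℝ) 1, ∀ v ∈ Icc (0 : ℝ) 1, c u ∈ K → c v ∈ K →
        ∀ t ∈ Ioo u v, c' t ∈ K) := by
  let T : Set ℝ := Icc 0 1 ∩ c ⁻¹' K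
  have hT : IsCompact T :=
    isCompact_Icc.of_isClosed_subset (hc.preimage_isClosed_of_isClosed isClosed_Icc hK)
      inter_subset_left
  by_cases hsub : T.Subsingleton
  · refine ⟨c, hc, rfl, rfl, le_self_add, fun _ _ => Or.inr rfl,
      fun _ _ _ _ _ => Or.inr fun _ _ => rfl, fun u hu v hv hcu hcv t ht => ?_⟩
    have := hsub ⟨hu, hcu⟩ ⟨hv, hcv⟩
    linarith [ht.1, ht.2]
  have hne : T.Nonempty := (not_subsingleton_iff.1 hsub).nonempty
  obtain ⟨a, ⟨⟨ha0, ha1⟩, haK⟩, hamin⟩ := hT.exists_isLeast hne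
  obtain ⟨b, ⟨⟨hb0, hb1⟩, hbK⟩, hbmax⟩ := hT.exists_isGreatest hne
  have hab : a < b := by
    by_contra hba
    refine hsub fun s hs t ht => le_antisymm ?_ ?_ <;>
      linarith [hamin hs, hbmax hs, hamin ht, hbmax ht]
  obtain ⟨g, g1, g2, g3, g4, g5⟩ := hj _ haK _ hbK a b hab
  obtain ⟨d, d1, dg, dc, d2⟩ := exists_glued_curve hab.le hb1 g1
    (hc.mono (Icc_subset_Icc hb0 le_rfl)) g3
  obtain ⟨k, k1, kc, kd, k2⟩ := exists_glued_curve ha0 (hab.le.trans hb1)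
    (hc.mono (Icc_subset_Icc le_rfl ha1)) d1 (g2.symm.trans (dg (left_mem_Icc.2 hab.le)).symm)
  have kK : ∀ t ∈ Icc a b, k t ∈ K := fun t ht => by
    rw [kd ⟨ht.1, ht.2.trans hb1⟩, dg ht]
    exact g4 ht
  have kc' : EqOn k c (Icc b 1) := fun t ht => by
    rw [kd ⟨hab.le.trans ht.1, ht.2⟩, dc ht]
  refine ⟨k, k1, kc ⟨le_rfl, ha0⟩, kc' ⟨hb1, le_rfl⟩, ?_, ?_, ?_, ?_⟩
  · have e1 := eVariationOn.Icc_add_Icc c (s := univ) ha0 hab.le (mem_univ a)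
    have e2 := eVariationOn.Icc_add_Icc c (s := univ) hb0 hb1 (mem_univ b)
    simp only [univ_inter] at e1 e2
    rw [k2, d2, ← e2, ← e1]
    calc _ ≤ eVariationOn c (Icc 0 a) + (ℓ + eVariationOn c (Icc b 1)) := by gcongr
      _ ≤ eVariationOn c (Icc 0 a) + (ℓ + eVariationOn c (Icc b 1)) +
          eVariationOn c (Icc a b) := le_self_add
      _ = _ := by ring
  · intro t ht
    rcases le_total t a with h | h
    · exact Or.inr (kc ⟨ht.1, h⟩)
    · rcases le_total t b with h' | h'
      · exact Or.inl (kK t ⟨h, h'⟩)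
      · exact Or.inr (kc' ⟨h', ht.2⟩)
  · intro u hu v hv havoid
    rcases le_or_gt v a with h | h
    · exact Or.inr fun t ht => kc ⟨hu.1.trans ht.1, ht.2.trans h⟩
    have hau : a ≤ u := not_lt.1 fun hua => havoid a ⟨hua, h⟩ haK
    rcases le_or_gt b u with h' | h'
    · exact Or.inr fun t ht => kc' ⟨h'.trans ht.1, ht.2.trans hv.2⟩
    have hvb : v ≤ b := not_lt.1 fun hbv => havoid b ⟨h', hbv⟩ hbK
    exact Or.inl fun t ht => kK t ⟨hau.trans ht.1.le, ht.2.le.trans hvb⟩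
  · intro u hu v hv hcu hcv t ht
    exact kK t ⟨(hamin ⟨hu, hcu⟩).trans ht.1.le, ht.2.le.trans (hbmax ⟨hv, hcv⟩)⟩

/-- If every excursion of a curve outside `C` starts and ends on a common set `K j` with `j ∈ S`,
then the curve can be rerouted inside `C`, each `K j` being used at most once. -/
theorem exists_rerouted_curve {ι : Type*} {C : Set X} {K : ι → Set X} {ℓ : ι → ℝ≥0∞}
    (hK : ∀ j, IsClosed (K j)) (hKC : ∀ j, K j ⊆ C)
    (hj : ∀ j, ∀ p ∈ K j, ∀ q ∈ K j, JoinedByLength (K j) p q (ℓ j)) (S : Finset ι)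
    {c : ℝ → X} (hc : ContinuousOn c (Icc 0 1))
    (hexc : ∀ t ∈ Icc (0 : ℝ) 1, c t ∉ C → ∃ j ∈ S, ∃ u ∈ Icc (0 : ℝ) 1, ∃ v ∈ Icc (0 : ℝ) 1,
      t ∈ Ioo u v ∧ c u ∈ K j ∧ c v ∈ K j ∧ ∀ s ∈ Ioo u v, c s ∉ C) :
    ∃ c' : ℝ → X, ContinuousOn c' (Icc 0 1) ∧ c' 0 = c 0 ∧ c' 1 = c 1 ∧
      MapsTo c' (Icc 0 1) C ∧
      eVariationOn c' (Icc 0 1) ≤ eVariationOn c (Icc 0 1) + ∑ j ∈ S, ℓ j := by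
  classical
  induction S using Finset.induction_on generalizing c with
  | empty =>
    refine ⟨c, hc, rfl, rfl, fun t ht => ?_, by simp⟩
    by_contra h
    obtain ⟨j, hjS, -⟩ := hexc t ht h
    simp at hjS
  | insert i S hi ih =>
    obtain ⟨d, d1, d2, d3, d4, dor, dgap, dmid⟩ := exists_shortcut (hK i) (hj i) hc
    obtain ⟨c', h1, h2, h3, h4, h5⟩ := ih d1 (fun t ht hdt => by
      have hdK : d t ∉ K i := fun h => hdt (hKC i h)
      have hct : c t ∉ C := by rwa [← (dor t ht).resolve_left hdK]
      obtain ⟨j, hjS, u, hu, v, hv, htuv, hcu, hcv, hgap⟩ := hexc t ht hct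
      have hji : j ≠ i := by
        rintro rfl
        exact hdK (dmid u hu v hv hcu hcv t htuv)
      have heq : EqOn d c (Icc u v) :=
        (dgap u hu v hv fun s hs h => hgap s hs (hKC i h)).resolve_left fun h => hdK (h t htuv)
      have huv : u ≤ v := (htuv.1.trans htuv.2).le
      refine ⟨j, (Finset.mem_insert.1 hjS).resolve_left hji, u, hu, v, hv, htuv, ?_, ?_, ?_⟩
      · rwa [heq (left_mem_Icc.2 huv)]
      · rwa [heq (right_mem_Icc.2 huv)]
      · intro s hs
        rw [heq (Ioo_subset_Icc_self hs)]
        exact hgap s hs)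
    refine ⟨c', h1, h2.trans d2, h3.trans d3, h4, ?_⟩
    rw [Finset.sum_insert hi, ← add_assoc]
    exact h5.trans (by gcongr)

/-- A time at which a curve with endpoints in the closed set `C` lies outside `C` belongs to an
excursion interval. -/
theorem exists_excursion_interval {C : Set X} (hC : IsClosed C) {c : ℝ → X}
    (hc : ContinuousOn c (Icc 0 1)) (h0 : c 0 ∈ C) (h1 : c 1 ∈ C) {t : ℝ}
    (ht : t ∈ Icc (0 : ℝ) 1) (htC : c t ∉ C) :
    ∃ u ∈ Icc (0 : ℝ) 1, ∃ v ∈ Icc (0 : ℝ) 1, t ∈ Ioo u v ∧ c u ∈ C ∧ c v ∈ C ∧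
      ∀ s ∈ Ioo u v, c s ∉ C := by
  let T : Set ℝ := Icc 0 1 ∩ c ⁻¹' C
  have hT : IsCompact T :=
    isCompact_Icc.of_isClosed_subset (hc.preimage_isClosed_of_isClosed isClosed_Icc hC)
      inter_subset_left
  obtain ⟨u, ⟨⟨hu, huC⟩, hut⟩, humax⟩ := (hT.inter_right isClosed_Iic).exists_isGreatest
    (⟨0, ⟨⟨le_rfl, zero_le_one⟩, h0⟩, ht.1⟩ : (T ∩ Iic t).Nonempty)
  obtain ⟨v, ⟨⟨hv, hvC⟩, htv⟩, hvmin⟩ := (hT.inter_right isClosed_Ici).exists_isLeast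
    (⟨1, ⟨⟨zero_le_one, le_rfl⟩, h1⟩, ht.2⟩ : (T ∩ Ici t).Nonempty)
  have hut' : u < t := lt_of_le_of_ne hut fun h => htC (h ▸ huC)
  have htv' : t < v := lt_of_le_of_ne htv fun h => htC (h ▸ hvC)
  refine ⟨u, hu, v, hv, ⟨hut', htv'⟩, huC, hvC, fun s hs hsC => ?_⟩
  have hsT : s ∈ T := ⟨⟨hu.1.trans hs.1.le, hs.2.le.trans hv.2⟩, hsC⟩
  rcases le_total s t with h | h
  · exact hs.1.not_ge (humax ⟨hsT, h⟩)
  · exact hs.2.not_ge (hvmin ⟨hsT, h⟩)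

end Curves

theorem chemical_distance_to_contour_landmark
    (C : Set Plane) (hne : C.Nonempty) (hcomp : IsCompact C)
    (hpc : IsPathConnected C) (hcl : C = closure (interior C))
    (n : ℕ) (γ : Fin n → ℝ → Plane)
    (hjordan : ∀ i, IsRectifiableJordanLoop (γ i))
    (hdisj : ∀ i j, i ≠ j → Disjoint (γ i '' Set.Icc 0 1) (γ j '' Set.Icc 0 1))
    (hfront : frontier C = ⋃ i, γ i '' Set.Icc 0 1) :
    ∃ i₀ : Fin n, ∀ z' ∈ γ i₀ '' Set.Icc 0 1, ∀ x ∈ C,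
      chemDist C x z' ≤ eVariationOn (γ i₀) (Set.Icc 0 1) +
        (1/2 : ℝ≥0∞) * ∑ j ∈ Finset.univ.erase i₀, eVariationOn (γ j) (Set.Icc 0 1) := by
  have hK : ∀ i, IsCompact (γ i '' Icc 0 1) := fun i =>
    isCompact_Icc.image_of_continuousOn (hjordan i).1
  have hKC : ∀ i, γ i '' Icc 0 1 ⊆ C := fun i => by
    refine subset_trans ?_ hcomp.isClosed.frontier_subset
    rw [hfront]
    exact subset_iUnion (fun j => γ j '' Icc 0 1) i
  have hcon : IsPreconnected C := hpc.isConnected.isPreconnected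
  have arcs : ∀ i, ∀ p ∈ γ i '' Icc 0 1, ∀ q ∈ γ i '' Icc 0 1,
      JoinedByLength (γ i '' Icc 0 1) p q (1 / 2 * eVariationOn (γ i) (Icc 0 1)) :=
    fun i p hp q hq => .of_loop (hjordan i).1 (hjordan i).2.1 hp hq
  obtain ⟨x₀, hx₀⟩ := hne
  obtain ⟨e, he⟩ := exists_ne (0 : Plane)
  obtain ⟨t₀, -, htip₀⟩ := hcomp.exists_isRayTip hx₀ he
  obtain ⟨i₀, hi₀, -⟩ := htip₀.exists_frontier_component hcon hcomp
    (fun i => (hK i).isClosed) hdisj hfront htip₀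
  refine ⟨i₀, fun z hz x hx => ?_⟩
  have hxz : edist x z ≤ 1 / 2 * eVariationOn (γ i₀) (Icc 0 1) := by
    by_cases hne : x = z
    · simp [hne]
    obtain ⟨t, ht, htip⟩ := hcomp.exists_isRayTip hx (sub_ne_zero.2 hne)
    obtain ⟨i, hi, hi'⟩ := htip.exists_frontier_component hcon hcomp
      (fun i => (hK i).isClosed) hdisj hfront htip₀
    obtain rfl : i = i₀ := by
      by_contra h
      exact (hdisj i i₀ h).le_bot ⟨hi', hi₀⟩
    obtain ⟨g, -, g0, g1, -, hg⟩ := arcs i _ hi z hz 0 1 zero_lt_one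
    refine le_trans ?_ hg
    refine le_trans ?_ (eVariationOn.edist_le g (left_mem_Icc.2 zero_le_one)
      (right_mem_Icc.2 zero_le_one))
    rw [g0, g1, edist_dist, edist_dist, dist_eq_norm, dist_eq_norm]
    refine ENNReal.ofReal_le_ofReal ?_
    have : x + t • (x - z) - z = (1 + t) • (x - z) := by module
    rw [this, norm_smul, Real.norm_of_nonneg (by positivity)]
    nlinarith [norm_nonneg (x - z)]
  have hseg : ContinuousOn (fun t : ℝ => AffineMap.lineMap x z t) (Icc 0 1) := by fun_prop
  obtain ⟨c, hc, hc0, hc1, hcC, hlen⟩ := exists_rerouted_curve (fun i => (hK i).isClosed) hKC arcs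
    Finset.univ hseg (fun t ht htC => by
      obtain ⟨u, hu, v, hv, htuv, huC, hvC, hgap⟩ := exists_excursion_interval hcomp.isClosed hseg
        (by simpa using hx) (by simpa using hKC i₀ hz) ht htC
      have huv : u < v := htuv.1.trans htuv.2
      have hsub : Icc u v ⊆ Icc (0 : ℝ) 1 := Icc_subset_Icc hu.1 hv.2
      have hcl : MapsTo (fun t : ℝ => AffineMap.lineMap x z t) (Icc u v) (closure Cᶜ) := by
        rw [← closure_Ioo huv.ne]
        refine MapsTo.closure_of_continuousOn (fun s hs => hgap s hs) ?_
        fun_prop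
      obtain ⟨j, hju, hjv⟩ := hcon.exists_frontier_component hcomp.isClosed
        (fun i => (hK i).isClosed) hdisj hfront
        (isPreconnected_Icc.image _ (hseg.mono hsub))
        (disjoint_left.2 (by
          rintro _ ⟨s, hs, rfl⟩
          have := hcl hs
          rwa [closure_compl] at this)) huC hvC
        (mem_image_of_mem _ (left_mem_Icc.2 huv.le)) (mem_image_of_mem _ (right_mem_Icc.2 huv.le))
      exact ⟨j, Finset.mem_univ j, u, hu, v, hv, htuv, hju, hjv, hgap⟩)
  have hsegvar : eVariationOn (fun t : ℝ => AffineMap.lineMap x z t) (Icc 0 1) ≤ edist x z := by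
    have h1 := (lipschitzWith_lineMap (𝕜 := ℝ) x z).lipschitzOnWith (s := univ)
      |>.comp_eVariationOn_le (g := (id : ℝ → ℝ)) (s := Icc 0 1) (mapsTo_univ _ _)
    have h2 := (monotone_id.monotoneOn (univ : Set ℝ)).eVariationOn_eq (mem_univ 0) (mem_univ 1)
    simp only [univ_inter, id, sub_zero, ENNReal.ofReal_one] at h2
    refine h1.trans ((mul_le_mul_right h2.le _).trans ?_)
    rw [mul_one, edist_nndist]
  calc chemDist C x z ≤ eVariationOn c (Icc 0 1) :=
        iInf₂_le c ⟨hc, by simpa using hc0, by simpa using hc1, hcC⟩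
    _ ≤ 1 / 2 * eVariationOn (γ i₀) (Icc 0 1) +
        ∑ j, 1 / 2 * eVariationOn (γ j) (Icc 0 1) :=
      hlen.trans (add_le_add_left (hsegvar.trans hxz) _)
    _ = _ := by
      rw [← Finset.add_sum_erase _ _ (Finset.mem_univ i₀), ← add_assoc, ← add_mul, one_div,
        ENNReal.inv_two_add_inv_two, one_mul, Finset.mul_sum]
end
end

section
/- Let γ : [0,1] → ℝ² be a continuous loop (γ(0) = γ(1)) of finite length V, let K = γ([0,1]), and let U be any bounded connected component of ℝ² ∖ K. Then the Euclidean diameter of K ∪ closure(U) is at most V/2. In particular, for a rectifiable Jordan curve the diameter of the closure of its interior is at most half its length. -/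
open Set
open scoped ENNReal

noncomputable section

/-- A bounded connected component of the complement of a nonempty set lies in the closed convex
hull of that set. -/
theorem connectedComponentIn_compl_subset_closure_convexHull
    {E : Type*} [NormedAddCommGroup E] [NormedSpace ℝ E] {K : Set E} (hK : K.Nonempty) {z : E}
    (hb : Bornology.IsBounded (connectedComponentIn Kᶜ z)) :
    connectedComponentIn Kᶜ z ⊆ closure (convexHull ℝ K) := by
  intro x hx
  by_contra hxC
  obtain ⟨f, u, hf, hu⟩ := geometric_hahn_banach_closed_point
    (convex_convexHull ℝ K).closure isClosed_closure hxC
  have hfK : ∀ a ∈ K, f a < u := fun a ha => hf a (subset_closure (subset_convexHull ℝ K ha))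
  obtain ⟨a, ha⟩ := hK
  have hfv : 0 < f (x - a) := by
    rw [map_sub]
    linarith [hfK a ha]
  set v := x - a
  have hv : 0 < ‖v‖ := by
    rw [norm_pos_iff]
    intro h
    simp [h] at hfv
  have hray : (fun t : ℝ => x + t • v) '' Ici 0 ⊆ connectedComponentIn Kᶜ z := by
    rw [connectedComponentIn_eq hx]
    refine IsPreconnected.subset_connectedComponentIn ?_ ⟨0, by simp, by simp⟩ ?_
    · exact isPreconnected_Ici.image _ (by fun_prop)
    · rintro _ ⟨t, ht, rfl⟩ hmem
      have h := hfK _ hmem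
      simp only [map_add, map_smul, smul_eq_mul] at h
      nlinarith [mul_nonneg (mem_Ici.mp ht) hfv.le]
  obtain ⟨R, hR⟩ := hb.exists_norm_le
  have hR0 : 0 ≤ R := (norm_nonneg x).trans (hR x hx)
  have ht : 0 ≤ (2 * R + 1) / ‖v‖ := by positivity
  have h₁ := hR _ (hray ⟨(2 * R + 1) / ‖v‖, ht, rfl⟩)
  have h₂ : ‖((2 * R + 1) / ‖v‖) • v‖ = 2 * R + 1 := by
    rw [norm_smul, Real.norm_of_nonneg ht, div_mul_cancel₀ _ hv.ne']
  have h₃ := norm_sub_le (x + ((2 * R + 1) / ‖v‖) • v) x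
  rw [add_sub_cancel_left, h₂] at h₃
  linarith [hR x hx]

/-- Two points of a loop are at distance at most half the length of the loop. -/
theorem two_mul_edist_le_eVariationOn_of_loop {E : Type*} [PseudoEMetricSpace E] {γ : ℝ → E}
    {a b : ℝ} (hloop : γ a = γ b) {s t : ℝ} (hs : s ∈ Icc a b) (ht : t ∈ Icc a b) :
    2 * edist (γ s) (γ t) ≤ eVariationOn γ (Icc a b) := by
  wlog hst : s ≤ t generalizing s t
  · rw [edist_comm]
    exact this ht hs (le_of_not_ge hst)
  have hab : a ≤ b := hs.1.trans hs.2
  have h₁ : edist (γ a) (γ s) ≤ eVariationOn γ (Icc a s) :=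
    eVariationOn.edist_le γ (left_mem_Icc.2 hs.1) (right_mem_Icc.2 hs.1)
  have h₂ : edist (γ s) (γ t) ≤ eVariationOn γ (Icc s t) :=
    eVariationOn.edist_le γ (left_mem_Icc.2 hst) (right_mem_Icc.2 hst)
  have h₃ : edist (γ t) (γ b) ≤ eVariationOn γ (Icc t b) :=
    eVariationOn.edist_le γ (left_mem_Icc.2 ht.2) (right_mem_Icc.2 ht.2)
  have h₄ : eVariationOn γ (Icc a s) + eVariationOn γ (Icc s t) = eVariationOn γ (Icc a t) := by
    simpa using eVariationOn.Icc_add_Icc γ (s := univ) hs.1 hst (mem_univ _)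
  have h₅ : eVariationOn γ (Icc a t) + eVariationOn γ (Icc t b) = eVariationOn γ (Icc a b) := by
    simpa using eVariationOn.Icc_add_Icc γ (s := univ) ht.1 ht.2 (mem_univ _)
  have htri : edist (γ s) (γ t) ≤ edist (γ a) (γ s) + edist (γ t) (γ b) := by
    rw [← hloop, edist_comm (γ a), edist_comm (γ t)]
    exact edist_triangle _ _ _
  calc 2 * edist (γ s) (γ t) = edist (γ s) (γ t) + edist (γ s) (γ t) := two_mul _
    _ ≤ (edist (γ a) (γ s) + edist (γ t) (γ b)) + edist (γ s) (γ t) := by gcongr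
    _ = edist (γ a) (γ s) + edist (γ s) (γ t) + edist (γ t) (γ b) := by ring
    _ ≤ eVariationOn γ (Icc a s) + eVariationOn γ (Icc s t) + eVariationOn γ (Icc t b) := by
      gcongr
    _ = eVariationOn γ (Icc a b) := by rw [h₄, h₅]

theorem diam_image_union_bounded_component_le_half_length
    (γ : ℝ → Plane) (hcont : ContinuousOn γ (Set.Icc 0 1)) (hloop : γ 0 = γ 1)
    (V : ℝ) (hV : eVariationOn γ (Set.Icc 0 1) = ENNReal.ofReal V)
    (K : Set Plane) (hK : K = γ '' Set.Icc 0 1)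
    (U : Set Plane) (z : Plane) (hz : z ∉ K) (hU : U = connectedComponentIn Kᶜ z)
    (hUbdd : Bornology.IsBounded U) :
    EMetric.diam (K ∪ closure U) ≤ ENNReal.ofReal (V / 2) := by
  have hne : K.Nonempty := hK ▸ (nonempty_Icc.2 zero_le_one).image γ
  have hsub : K ∪ closure U ⊆ closure (convexHull ℝ K) := by
    refine union_subset ((subset_convexHull ℝ K).trans subset_closure) ?_
    refine closure_minimal ?_ isClosed_closure
    subst hU
    exact connectedComponentIn_compl_subset_closure_convexHull hne hUbdd
  refine (Metric.ediam_mono hsub).trans ?_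
  rw [Metric.ediam_closure, convexHull_ediam, hK]
  refine Metric.ediam_le ?_
  rintro _ ⟨s, hs, rfl⟩ _ ⟨t, ht, rfl⟩
  have h := two_mul_edist_le_eVariationOn_of_loop hloop hs ht
  rw [hV] at h
  rw [ENNReal.ofReal_div_of_pos two_pos, ENNReal.ofReal_ofNat,
    ENNReal.le_div_iff_mul_le (by simp) (by simp), mul_comm]
  exact h
end
end
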